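/- As p → ∞, both Λ_p(Ω)^{1/p} and Λ_p(Ω)^{1/p} |Ω|^{−1/p} converge to 1/‖ρ‖_∞, where ρ(x) := dist(x, Ωᶜ) is the distance function to the boundary and ‖ρ‖_∞ := sup_{x∈Ω} ρ(x). -/

import Mathlib

open MeasureTheory Filter Topology Metric

noncomputable def LambdaP {N : ℕ} (Ω : Set (EuclideanSpace ℝ (Fin N))) (p : ℝ) : ℝ :=
  sInf { c : ℝ | ∃ u : EuclideanSpace ℝ (Fin N) → ℝ,
    ContDiff ℝ (⊤ : ℕ∞) u ∧ HasCompactSupport u ∧ tsupport u ⊆ Ω ∧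
    sSup ((fun x => |u x|) '' Ω) = 1 ∧
    c = ∫ x in Ω, ‖gradient u x‖ ^ p }

lemma aux_ftc {E : Type*} [NormedAddCommGroup E] [NormedSpace ℝ E] (u : E → ℝ)
    (hu : ContDiff ℝ 1 u) (x z : E) :
    |u x - u z| ≤ ‖z - x‖ * ∫ t in Set.Ioc (0:ℝ) 1, ‖fderiv ℝ u (x + t • (z - x))‖ := by
  have hc : Continuous (fun t : ℝ => fderiv ℝ u (x + t • (z - x))) :=
    (hu.continuous_fderiv one_ne_zero).comp (by fun_prop)
  have hd : ∀ t : ℝ, HasDerivAt (fun t : ℝ => u (x + t • (z - x)))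
      (fderiv ℝ u (x + t • (z - x)) (z - x)) t := by
    intro t
    have h1 : HasDerivAt (fun t : ℝ => x + t • (z - x)) (z - x) t := by
      simpa using ((hasDerivAt_id t).smul_const (z - x)).const_add x
    exact ((hu.differentiable one_ne_zero) _).hasFDerivAt.comp_hasDerivAt t h1
  have h2 := intervalIntegral.integral_eq_sub_of_hasDerivAt (a := 0) (b := 1)
    (fun t _ => hd t) ((hc.clm_apply continuous_const).intervalIntegrable _ _)
  simp only [one_smul, zero_smul, add_zero, add_sub_cancel] at h2
  rw [abs_sub_comm, ← h2, intervalIntegral.integral_of_le zero_le_one, ← integral_const_mul]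
  have hi : IntegrableOn (fun t : ℝ => ‖z - x‖ * ‖fderiv ℝ u (x + t • (z - x))‖) (Set.Ioc 0 1) :=
    ((continuous_const.mul hc.norm).intervalIntegrable (0:ℝ) 1).1
  rw [← Real.norm_eq_abs]
  refine norm_integral_le_of_norm_le hi (Eventually.of_forall fun t => ?_)
  rw [mul_comm]
  exact ContinuousLinearMap.le_opNorm _ _

lemma aux_holder {N : ℕ} (g : EuclideanSpace ℝ (Fin N) → ℝ) (hg : Continuous g)
    (hgc : HasCompactSupport g) (hg0 : ∀ x, 0 ≤ g x) (p : ℝ) (hp : 1 < p)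
    (x m : EuclideanSpace ℝ (Fin N)) (ε t : ℝ) (ht : 0 < t) :
    ∫ z in ball m ε, g (x + t • (z - x)) ≤
      (volume (ball m ε)).toReal ^ (1 - 1 / p) * (t ^ (-(N / p)) * (∫ z, g z ^ p) ^ (1 / p)) := by
  have hpq : p.HolderConjugate (Real.conjExponent p) := Real.HolderConjugate.conjExponent hp
  have hp0 : 0 < p := by linarith
  let φ : EuclideanSpace ℝ (Fin N) → EuclideanSpace ℝ (Fin N) := fun z => x + t • (z - x)
  have hφ : Continuous φ := by fun_prop
  obtain ⟨C, hC⟩ := hg.bounded_above_of_compact_support hgc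
  have hm1 : MemLp (fun z => g (φ z)) (ENNReal.ofReal p) (volume.restrict (ball m ε)) := by
    have : IsFiniteMeasure (volume.restrict (ball m ε)) := ⟨by simpa using measure_ball_lt_top⟩
    exact MemLp.of_bound (hg.comp hφ).aestronglyMeasurable C (Eventually.of_forall fun z => hC _)
  have hm2 : MemLp (fun z : EuclideanSpace ℝ (Fin N) => (1:ℝ)) (ENNReal.ofReal (Real.conjExponent p))
      (volume.restrict (ball m ε)) := by
    have : IsFiniteMeasure (volume.restrict (ball m ε)) := ⟨by simpa using measure_ball_lt_top⟩
    exact memLp_const 1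
  have h := integral_mul_le_Lp_mul_Lq_of_nonneg hpq (Eventually.of_forall fun z => hg0 (φ z))
    (Eventually.of_forall fun z => zero_le_one) hm1 hm2
  have hgp : Continuous (fun z => g z ^ p) := hg.rpow_const (fun _ => Or.inr hp0.le)
  have hgpc : HasCompactSupport (fun z => g z ^ p) :=
    hgc.comp_left (g := fun y : ℝ => y ^ p) (Real.zero_rpow hp0.ne')
  have hcomp : ∀ z, φ z = t • z + (x - t • x) := by
    intro z; simp only [φ, smul_sub]; abel
  have hcv : ∫ z, g (φ z) ^ p = t ^ (-(N:ℝ)) * ∫ z, g z ^ p := by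
    simp only [hcomp]
    have := Measure.integral_comp_smul_of_nonneg (volume : Measure (EuclideanSpace ℝ (Fin N)))
      (fun y => g (y + (x - t • x)) ^ p) t (hR := ht.le)
    rw [this, integral_add_right_eq_self (fun y => g y ^ p)]
    simp [Real.rpow_neg ht.le]
  have hint : Integrable (fun z => g (φ z) ^ p) := by
    simp only [hcomp]
    have h1 : Integrable (fun y => g (y + (x - t • x)) ^ p) :=
      (hgp.integrable_of_hasCompactSupport hgpc).comp_add_right (x - t • x)
    exact h1.comp_smul ht.ne'
  have hle : ∫ z in ball m ε, g (φ z) ^ p ≤ t ^ (-(N:ℝ)) * ∫ z, g z ^ p := by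
    rw [← hcv]
    exact setIntegral_le_integral hint (Eventually.of_forall fun z => Real.rpow_nonneg (hg0 _) _)
  have hI : 0 ≤ ∫ z, g z ^ p := integral_nonneg fun z => Real.rpow_nonneg (hg0 _) _
  have h1q : 1 / Real.conjExponent p = 1 - 1 / p := by
    have := hpq.inv_add_inv_eq_one
    simp only [one_div]; linarith
  simp only [mul_one, Real.one_rpow, integral_const, smul_eq_mul, h1q] at h
  refine h.trans ?_
  rw [mul_comm]
  simp only [measureReal_def, Measure.restrict_apply_univ]
  gcongr
  refine (Real.rpow_le_rpow (integral_nonneg fun z => Real.rpow_nonneg (hg0 _) _) hle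
    (by positivity)).trans (le_of_eq ?_)
  rw [Real.mul_rpow (by positivity) hI, ← Real.rpow_mul ht.le]
  congr 2; ring

lemma aux_morrey {N : ℕ} (u : EuclideanSpace ℝ (Fin N) → ℝ) (hu : ContDiff ℝ 1 u)
    (huc : HasCompactSupport u) (p : ℝ) (hp : 1 < p) (hpN : N < p)
    (x m : EuclideanSpace ℝ (Fin N)) (ε : ℝ) (hε : 0 < ε) :
    ∫ z in ball m ε, |u x - u z| ≤ (dist x m + ε) *
      ((volume (ball m ε)).toReal ^ (1 - 1 / p) * ((1 - N / p)⁻¹ *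
        (∫ z, ‖fderiv ℝ u z‖ ^ p) ^ (1 / p))) := by
  have hp0 : 0 < p := by linarith
  set g : EuclideanSpace ℝ (Fin N) → ℝ := fun z => ‖fderiv ℝ u z‖ with hgdef
  have hg : Continuous g := (hu.continuous_fderiv one_ne_zero).norm
  have hgc : HasCompactSupport g := (huc.fderiv ℝ).norm
  have hg0 : ∀ z, 0 ≤ g z := fun z => norm_nonneg _
  obtain ⟨C, hC⟩ := hg.bounded_above_of_compact_support hgc
  have : IsFiniteMeasure (volume.restrict (ball m ε)) := ⟨by simpa using measure_ball_lt_top⟩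
  have hF : Integrable (Function.uncurry fun (z : EuclideanSpace ℝ (Fin N)) (t : ℝ) =>
      g (x + t • (z - x))) ((volume.restrict (ball m ε)).prod (volume.restrict (Set.Ioc (0:ℝ) 1))) := by
    refine Integrable.of_bound (C := C) (Continuous.aestronglyMeasurable ?_)
      (Eventually.of_forall fun z => hC _)
    exact hg.comp (by fun_prop)
  have step1 : ∫ z in ball m ε, |u x - u z| ≤ (dist x m + ε) *
      ∫ z in ball m ε, ∫ t in Set.Ioc (0:ℝ) 1, g (x + t • (z - x)) := by
    rw [← integral_const_mul]
    refine setIntegral_mono_on ?_ ?_ measurableSet_ball ?_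
    · have : Continuous fun z => |u x - u z| := (continuous_const.sub hu.continuous).abs
      exact (this.locallyIntegrable.integrableOn_isCompact (isCompact_closedBall m ε)).mono_set
        ball_subset_closedBall
    · exact hF.integral_prod_left.const_mul _
    · intro z hz
      refine (aux_ftc u hu x z).trans ?_
      refine mul_le_mul_of_nonneg_right ?_ (integral_nonneg fun t => hg0 _)
      rw [← dist_eq_norm, dist_comm]
      have := dist_triangle_right x z m
      rw [mem_ball] at hz
      linarith
  refine step1.trans (mul_le_mul_of_nonneg_left ?_ (by positivity))
  rw [integral_integral_swap hF]
  have hr : (-1:ℝ) < -(N / p) := by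
    have : (N:ℝ) / p < 1 := (div_lt_one hp0).2 hpN
    linarith
  have hI : ∫ t in Set.Ioc (0:ℝ) 1, t ^ (-((N:ℝ) / p)) = (1 - N / p)⁻¹ := by
    rw [← intervalIntegral.integral_of_le zero_le_one, integral_rpow (Or.inl hr)]
    rw [Real.one_rpow, Real.zero_rpow (by linarith)]
    rw [sub_zero, one_div]; congr 1; ring
  rw [← hI, ← integral_mul_const, ← integral_const_mul]
  refine setIntegral_mono_on hF.integral_prod_right ?_ measurableSet_Ioc ?_
  · exact ((intervalIntegral.intervalIntegrable_rpow' hr (a := 0) (b := 1)).1.mul_const _).const_mul _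
  · intro t ht
    exact aux_holder g hg hgc hg0 p hp x m ε t ht.1

lemma aux_pt {N : ℕ} (u : EuclideanSpace ℝ (Fin N) → ℝ) (hu : ContDiff ℝ 1 u)
    (huc : HasCompactSupport u) (p : ℝ) (hp : 1 < p) (hpN : N < p)
    (x y : EuclideanSpace ℝ (Fin N)) (ε : ℝ) (hε : 0 < ε) :
    |u x - u y| * (volume (ball (0 : EuclideanSpace ℝ (Fin N)) ε)).toReal ^ (1 / p) * (1 - N / p) ≤
      (dist x y + 2 * ε) * (∫ z, ‖fderiv ℝ u z‖ ^ p) ^ (1 / p) := by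
  have hp0 : 0 < p := by linarith
  have h1 := aux_morrey u hu huc p hp hpN x x ε hε
  have h2 := aux_morrey u hu huc p hp hpN y x ε hε
  set V := (volume (ball x ε)).toReal with hV
  have hV' : (volume (ball (0 : EuclideanSpace ℝ (Fin N)) ε)).toReal = V := by
    rw [hV, Measure.addHaar_ball_center volume x]
  have hV0 : 0 < V := ENNReal.toReal_pos (measure_ball_pos _ _ hε).ne' measure_ball_lt_top.ne
  rw [hV']
  set G := (∫ z, ‖fderiv ℝ u z‖ ^ p) ^ (1 / p)
  have hi : ∀ a, IntegrableOn (fun z => |u a - u z|) (ball x ε) := by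
    intro a
    have : Continuous fun z => |u a - u z| := (continuous_const.sub hu.continuous).abs
    exact (this.locallyIntegrable.integrableOn_isCompact (isCompact_closedBall x ε)).mono_set
        ball_subset_closedBall
  have h3 : V * |u x - u y| ≤ (∫ z in ball x ε, |u x - u z|) + ∫ z in ball x ε, |u y - u z| := by
    rw [← integral_add (hi x) (hi y)]
    have : V * |u x - u y| = ∫ z in ball x ε, |u x - u y| := by
      simp [hV, measureReal_def]
    rw [this]
    have : IsFiniteMeasure (volume.restrict (ball x ε)) := ⟨by simpa using measure_ball_lt_top⟩
    refine integral_mono (integrable_const _) ((hi x).add (hi y)) fun z => ?_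
    have := abs_sub_le (u x) (u z) (u y)
    rw [abs_sub_comm (u z) (u y)] at this
    exact this
  have hq : 0 < 1 - (N:ℝ) / p := by
    have : (N:ℝ) / p < 1 := (div_lt_one hp0).2 hpN
    linarith
  have h4 : V * |u x - u y| ≤ (dist x y + 2 * ε) * (V ^ (1 - 1 / p) * ((1 - N / p)⁻¹ * G)) := by
    refine h3.trans ((add_le_add h1 h2).trans (le_of_eq ?_))
    rw [dist_self, dist_comm y x]; ring
  rw [Real.rpow_sub hV0, Real.rpow_one] at h4
  have hW : 0 < V ^ (1 / p) := Real.rpow_pos_of_pos hV0 _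
  set W := V ^ (1 / p)
  have h5 : (dist x y + 2 * ε) * (V / W * ((1 - N / p)⁻¹ * G)) =
     V * ((dist x y + 2 * ε) * G / (W * (1 - N / p))) := by
    rw [mul_comm W, div_mul_eq_div_div]
    field_simp
  rw [h5, mul_le_mul_iff_right₀ hV0, le_div_iff₀ (by positivity)] at h4
  linarith

lemma aux_test {N : ℕ} (x0 : EuclideanSpace ℝ (Fin N)) (r s : ℝ) (hr : 0 < r) (hrs : r < s) :
    ∃ u : EuclideanSpace ℝ (Fin N) → ℝ, ContDiff ℝ (⊤ : ℕ∞) u ∧ LipschitzWith 1 u ∧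
      tsupport u ⊆ ball x0 s ∧ r ≤ u x0 := by
  obtain ⟨δ, hδ, hδs⟩ : ∃ δ : ℝ, 0 < δ ∧ r + 3 * δ < s := ⟨(s - r) / 4, by linarith, by linarith⟩
  let f : EuclideanSpace ℝ (Fin N) → ℝ := fun x => max (r + 2 * δ - dist x x0) 0
  have hf : LipschitzWith 1 f := by
    refine LipschitzWith.of_dist_le_mul fun x y => ?_
    simp only [NNReal.coe_one, one_mul, Real.dist_eq, f]
    refine (abs_max_sub_max_le_abs _ _ _).trans ?_
    have := abs_dist_sub_le y x x0
    rw [dist_comm y x] at this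
    have e : r + 2 * δ - dist x x0 - (r + 2 * δ - dist y x0) = dist y x0 - dist x x0 := by ring
    rw [e]
    exact this
  let φ : ContDiffBump (0 : EuclideanSpace ℝ (Fin N)) := ⟨δ / 2, δ, by linarith, by linarith⟩
  have hφc : Continuous (φ.normed volume) := φ.continuous_normed
  have hi : ∀ x, Integrable (fun t => φ.normed volume t * f (x - t)) := fun x =>
    (hφc.mul (hf.continuous.comp (by fun_prop))).integrable_of_hasCompactSupport
      (φ.hasCompactSupport_normed.mul_right)
  let v : EuclideanSpace ℝ (Fin N) → ℝ :=
    MeasureTheory.convolution (φ.normed volume) f (ContinuousLinearMap.lsmul ℝ ℝ) volume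
  have hv : ∀ x, v x = ∫ t, φ.normed volume t * f (x - t) := fun x => rfl
  refine ⟨v, ?_, ?_, ?_, ?_⟩
  · exact φ.hasCompactSupport_normed.contDiff_convolution_left _ φ.contDiff_normed
      hf.continuous.locallyIntegrable
  · refine LipschitzWith.of_dist_le_mul fun x y => ?_
    rw [Real.dist_eq, hv, hv, ← integral_sub (hi x) (hi y), NNReal.coe_one, one_mul,
      ← Real.norm_eq_abs]
    have : dist x y = ∫ t, φ.normed volume t * dist x y := by
      rw [integral_mul_const, φ.integral_normed, one_mul]
    rw [this]
    refine norm_integral_le_of_norm_le (φ.integrable_normed.mul_const _)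
      (Eventually.of_forall fun t => ?_)
    rw [← mul_sub, norm_mul, Real.norm_of_nonneg (φ.nonneg_normed t)]
    refine mul_le_mul_of_nonneg_left ?_ (φ.nonneg_normed t)
    rw [← dist_eq_norm]
    simpa using hf.dist_le_mul (x - t) (y - t)
  · have hsub : Function.support v ⊆ closedBall x0 (r + 3 * δ) := by
      intro x hx
      by_contra hx'
      apply hx
      rw [hv]
      refine integral_eq_zero_of_ae (Eventually.of_forall fun t => ?_)
      by_cases ht : t ∈ Function.support (φ.normed volume)
      · rw [φ.support_normed_eq, mem_ball_zero_iff] at ht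
        change ‖t‖ < δ at ht
        rw [mem_closedBall, not_le] at hx'
        have h1 : dist x x0 ≤ dist (x - t) x0 + ‖t‖ := by
          have := dist_triangle x (x - t) x0
          rw [dist_self_sub_right] at this
          linarith
        have : f (x - t) = 0 := max_eq_right (by linarith)
        simp [this]
      · rw [Function.notMem_support] at ht
        simp [ht]
    refine (closure_minimal hsub isClosed_closedBall).trans (closedBall_subset_ball hδs)
  · have h1 : dist (v x0) (f x0) ≤ δ := by
      refine φ.dist_normed_convolution_le hf.continuous.aestronglyMeasurable ?_
      intro x hx
      have := hf.dist_le_mul x x0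
      rw [mem_ball] at hx
      change dist x x0 < δ at hx
      simp only [NNReal.coe_one, one_mul] at this
      linarith
    have h2 : f x0 = r + 2 * δ := by simp only [f, dist_self, sub_zero]; exact max_eq_left (by linarith)
    rw [h2, Real.dist_eq] at h1
    have := (abs_le.1 h1).1
    linarith

lemma aux_grad {N : ℕ} (u : EuclideanSpace ℝ (Fin N) → ℝ) (x : EuclideanSpace ℝ (Fin N)) :
    ‖gradient u x‖ = ‖fderiv ℝ u x‖ := by
  rw [gradient, LinearIsometryEquiv.norm_map]

lemma aux_mem {N : ℕ} (Ω : Set (EuclideanSpace ℝ (Fin N))) (hΩb : Bornology.IsBounded Ω)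
    (x0 : EuclideanSpace ℝ (Fin N)) (r s : ℝ) (hr : 0 < r) (hrs : r < s) (hball : ball x0 s ⊆ Ω) :
    ∃ u : EuclideanSpace ℝ (Fin N) → ℝ,
      ContDiff ℝ (⊤ : ℕ∞) u ∧ HasCompactSupport u ∧ tsupport u ⊆ Ω ∧
      sSup ((fun x => |u x|) '' Ω) = 1 ∧ ∀ x, ‖gradient u x‖ ≤ 1 / r := by
  obtain ⟨v, hv1, hv2, hv3, hv4⟩ := aux_test x0 r s hr hrs
  have hvc : HasCompactSupport v := by
    refine IsCompact.of_isClosed_subset (isCompact_closedBall x0 s) (isClosed_tsupport _)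
      (hv3.trans ball_subset_closedBall)
  obtain ⟨xm, hxm⟩ := hv1.continuous.abs.exists_forall_ge_of_hasCompactSupport (hvc.abs)
  set M := |v xm| with hM
  have hrM : r ≤ M := hv4.trans ((le_abs_self _).trans (hxm x0))
  have hM0 : 0 < M := hr.trans_le hrM
  have hxmΩ : xm ∈ Ω := hball (hv3 (subset_tsupport _ (by
    rw [Function.mem_support]; intro h; rw [hM, h, abs_zero] at hM0; exact lt_irrefl _ hM0)))
  refine ⟨fun x => M⁻¹ * v x, contDiff_const.mul hv1, hvc.mul_left, ?_, ?_, ?_⟩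
  · exact (closure_mono (Function.support_mul_subset_right _ _)).trans (hv3.trans hball)
  · refine IsGreatest.csSup_eq ⟨⟨xm, hxmΩ, ?_⟩, ?_⟩
    · simp only [abs_mul, abs_inv, ← hM, abs_of_pos hM0]
      exact inv_mul_cancel₀ hM0.ne'
    · rintro _ ⟨x, -, rfl⟩
      simp only [abs_mul, abs_inv, abs_of_pos hM0]
      rw [inv_mul_le_iff₀ hM0, mul_one]
      exact hxm x
  · intro x
    rw [aux_grad, fderiv_const_mul (hv1.differentiable (by simp) x), norm_smul, norm_inv,
      Real.norm_of_nonneg hM0.le, one_div]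
    have : ‖fderiv ℝ v x‖ ≤ 1 := by simpa using norm_fderiv_le_of_lipschitz ℝ hv2
    calc M⁻¹ * ‖fderiv ℝ v x‖ ≤ M⁻¹ * 1 := by gcongr
      _ ≤ r⁻¹ := by rw [mul_one]; gcongr

lemma aux_upper {N : ℕ} (Ω : Set (EuclideanSpace ℝ (Fin N))) (hΩb : Bornology.IsBounded Ω)
    (x0 : EuclideanSpace ℝ (Fin N)) (r s : ℝ) (hr : 0 < r) (hrs : r < s) (hball : ball x0 s ⊆ Ω)
    (p : ℝ) (hp : 0 < p) :
    LambdaP Ω p ^ (1 / p) ≤ 1 / r * (volume Ω).toReal ^ (1 / p) := by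
  obtain ⟨u, h1, h2, h3, h4, h5⟩ := aux_mem Ω hΩb x0 r s hr hrs hball
  have hL0 : 0 ≤ LambdaP Ω p := by
    refine Real.sInf_nonneg ?_
    rintro c ⟨u, -, -, -, -, rfl⟩
    exact integral_nonneg fun x => Real.rpow_nonneg (norm_nonneg _) _
  have hL : LambdaP Ω p ≤ ∫ x in Ω, ‖gradient u x‖ ^ p := by
    refine csInf_le ⟨0, ?_⟩ ⟨u, h1, h2, h3, h4, rfl⟩
    rintro c ⟨u, -, -, -, -, rfl⟩
    exact integral_nonneg fun x => Real.rpow_nonneg (norm_nonneg _) _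
  have h6 : ∫ x in Ω, ‖gradient u x‖ ^ p ≤ (1 / r) ^ p * (volume Ω).toReal := by
    have hb : ∀ x ∈ Ω, ‖‖gradient u x‖ ^ p‖ ≤ (1 / r) ^ p := by
      intro x _
      rw [Real.norm_of_nonneg (Real.rpow_nonneg (norm_nonneg _) _)]
      exact Real.rpow_le_rpow (norm_nonneg _) (h5 x) hp.le
    exact (le_abs_self _).trans (norm_setIntegral_le_of_norm_le_const hΩb.measure_lt_top hb)
  refine (Real.rpow_le_rpow hL0 (hL.trans h6) (by positivity)).trans (le_of_eq ?_)
  rw [Real.mul_rpow (by positivity) (by positivity), ← Real.rpow_mul (by positivity),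
    mul_one_div_cancel hp.ne', Real.rpow_one]

lemma aux_lower {N : ℕ} (Ω : Set (EuclideanSpace ℝ (Fin N))) (hΩo : IsOpen Ω)
    (hΩb : Bornology.IsBounded Ω) (hΩne : Ω.Nonempty) (hc : (Ωᶜ).Nonempty) (R : ℝ)
    (hR : ∀ x ∈ Ω, infDist x Ωᶜ ≤ R) (hR0 : 0 < R) (ε : ℝ) (hε : 0 < ε)
    (p : ℝ) (hp : 1 < p) (hpN : N < p) :
    (volume (ball (0 : EuclideanSpace ℝ (Fin N)) ε)).toReal ^ (1 / p) * (1 - N / p) / (R + 2 * ε)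
      ≤ LambdaP Ω p ^ (1 / p) := by
  have hp0 : 0 < p := by linarith
  have hq : 0 < 1 - (N:ℝ) / p := by
    have : (N:ℝ) / p < 1 := (div_lt_one hp0).2 hpN
    linarith
  set V := (volume (ball (0 : EuclideanSpace ℝ (Fin N)) ε)).toReal with hV
  have hV0 : 0 ≤ V := ENNReal.toReal_nonneg
  have hb0 : 0 ≤ V ^ (1 / p) * (1 - N / p) / (R + 2 * ε) := by positivity
  set b := V ^ (1 / p) * (1 - N / p) / (R + 2 * ε) with hb
  have key : b ^ p ≤ LambdaP Ω p := by
    refine le_csInf ?_ ?_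
    · obtain ⟨x0, hx0⟩ := hΩne
      obtain ⟨s, hs, hsb⟩ := Metric.isOpen_iff.1 hΩo x0 hx0
      obtain ⟨u, h1, h2, h3, h4, -⟩ := aux_mem Ω hΩb x0 (s / 2) s (by linarith) (by linarith) hsb
      exact ⟨_, u, h1, h2, h3, h4, rfl⟩
    · rintro c ⟨u, h1, h2, h3, h4, rfl⟩
      have hI : ∫ x in Ω, ‖gradient u x‖ ^ p = ∫ x, ‖fderiv ℝ u x‖ ^ p := by
        simp only [aux_grad]
        refine setIntegral_eq_integral_of_forall_compl_eq_zero fun x hx => ?_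
        have : fderiv ℝ u x = 0 := by
          by_contra h
          exact hx (h3 (support_fderiv_subset ℝ h))
        rw [this, norm_zero, Real.zero_rpow hp0.ne']
      rw [hI]
      set G := ∫ x, ‖fderiv ℝ u x‖ ^ p with hG
      have hG0 : 0 ≤ G := integral_nonneg fun x => Real.rpow_nonneg (norm_nonneg _) _
      have hpt : ∀ x ∈ Ω, |u x| * (V ^ (1 / p) * (1 - N / p)) ≤ (R + 2 * ε) * G ^ (1 / p) := by
        intro x hx
        obtain ⟨y, hy, hxy⟩ := hΩo.isClosed_compl.exists_infDist_eq_dist hc x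
        have hy0 : u y = 0 := image_eq_zero_of_notMem_tsupport fun h => hy (h3 h)
        have := aux_pt u (h1.of_le (by exact_mod_cast le_top)) h2 p hp hpN x y ε hε
        rw [hy0, sub_zero, mul_assoc] at this
        refine this.trans ?_
        have := hR x hx
        rw [hxy] at this
        gcongr
      have hbG : b ≤ G ^ (1 / p) := by
        rw [hb, div_le_iff₀ (by positivity), mul_comm (G ^ (1 / p))]
        rcases (show 0 ≤ V ^ (1 / p) * (1 - N / p) by positivity).eq_or_lt with h0 | h0
        · rw [← h0]; positivity
        · have : sSup ((fun x => |u x|) '' Ω) ≤ (R + 2 * ε) * G ^ (1 / p) / (V ^ (1 / p) * (1 - N / p)) := by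
            refine csSup_le (hΩne.image _) ?_
            rintro _ ⟨x, hx, rfl⟩
            rw [le_div_iff₀ h0]
            exact hpt x hx
          rwa [h4, le_div_iff₀ h0, one_mul] at this
      calc b ^ p ≤ (G ^ (1 / p)) ^ p := Real.rpow_le_rpow hb0 hbG hp0.le
        _ = G := by rw [← Real.rpow_mul hG0, one_div_mul_cancel hp0.ne', Real.rpow_one]
  calc b = (b ^ p) ^ (1 / p) := by rw [← Real.rpow_mul hb0, mul_one_div_cancel hp0.ne', Real.rpow_one]
    _ ≤ _ := Real.rpow_le_rpow (by positivity) key (by positivity)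

lemma aux_lim (c : ℝ) (hc : 0 < c) : Tendsto (fun p : ℝ => c ^ (1 / p)) atTop (𝓝 1) := by
  have h : Tendsto (fun p : ℝ => 1 / p) atTop (𝓝 0) := by
    simpa using tendsto_inv_atTop_zero (𝕜 := ℝ)
  have := (Real.continuousAt_const_rpow (b := 0) hc.ne').tendsto.comp h
  simpa [Function.comp_def] using this

theorem stmt12 {N : ℕ} (hN : 2 ≤ N) (Ω : Set (EuclideanSpace ℝ (Fin N)))
    (hΩo : IsOpen Ω) (hΩb : Bornology.IsBounded Ω) (hΩne : Ω.Nonempty) :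
    Tendsto (fun p => LambdaP Ω p ^ (1 / p)) atTop
        (𝓝 (1 / sSup ((fun x => infDist x Ωᶜ) '' Ω))) ∧
    Tendsto (fun p => LambdaP Ω p ^ (1 / p) * (volume Ω).toReal ^ (-(1 / p))) atTop
        (𝓝 (1 / sSup ((fun x => infDist x Ωᶜ) '' Ω))) := by
  have hc : (Ωᶜ).Nonempty := by
    rw [Set.nonempty_compl]
    rintro rfl
    have : Nonempty (Fin N) := ⟨⟨0, by omega⟩⟩
    have : Nontrivial (EuclideanSpace ℝ (Fin N)) := inferInstance
    exact NormedSpace.unbounded_univ ℝ (EuclideanSpace ℝ (Fin N)) hΩb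
  have hbdd : BddAbove ((fun x => infDist x Ωᶜ) '' Ω) := by
    obtain ⟨y, hy⟩ := hc
    obtain ⟨D, hD⟩ := hΩb.subset_closedBall y
    refine ⟨D, ?_⟩
    rintro _ ⟨x, hx, rfl⟩
    exact (infDist_le_dist_of_mem hy).trans (hD hx)
  set R := sSup ((fun x => infDist x Ωᶜ) '' Ω) with hRdef
  have hR : ∀ x ∈ Ω, infDist x Ωᶜ ≤ R := fun x hx => le_csSup hbdd ⟨x, hx, rfl⟩
  have hR0 : 0 < R := by
    obtain ⟨x, hx⟩ := hΩne
    refine lt_of_lt_of_le ?_ (hR x hx)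
    exact (hΩo.isClosed_compl.notMem_iff_infDist_pos hc).1 (fun h => h hx)
  have hvol : 0 < (volume Ω).toReal :=
    ENNReal.toReal_pos (hΩo.measure_pos volume hΩne).ne' hΩb.measure_lt_top.ne
  have main : Tendsto (fun p => LambdaP Ω p ^ (1 / p)) atTop (𝓝 (1 / R)) := by
    refine tendsto_order.2 ⟨fun a ha => ?_, fun a ha => ?_⟩
    · obtain ⟨ε, hε, hεa⟩ : ∃ ε : ℝ, 0 < ε ∧ a < 1 / (R + 2 * ε) := by
        have h : Tendsto (fun ε : ℝ => 1 / (R + 2 * ε)) (𝓝[>] 0) (𝓝 (1 / R)) := by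
          have : ContinuousAt (fun ε : ℝ => 1 / (R + 2 * ε)) 0 := by
            refine continuousAt_const.div (by fun_prop) (by simpa using hR0.ne')
          have := this.tendsto
          simp only [mul_zero, add_zero] at this
          exact this.mono_left nhdsWithin_le_nhds
        obtain ⟨ε, h1, h2⟩ := ((h.eventually (lt_mem_nhds ha)).and self_mem_nhdsWithin).exists
        exact ⟨ε, h2, h1⟩
      have hV : 0 < (volume (ball (0 : EuclideanSpace ℝ (Fin N)) ε)).toReal :=
        ENNReal.toReal_pos (measure_ball_pos _ _ hε).ne' measure_ball_lt_top.ne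
      have hlim : Tendsto (fun p : ℝ => (volume (ball (0 : EuclideanSpace ℝ (Fin N)) ε)).toReal ^ (1 / p)
          * (1 - N / p) / (R + 2 * ε)) atTop (𝓝 (1 / (R + 2 * ε))) := by
        have h2 : Tendsto (fun p : ℝ => 1 - (N:ℝ) / p) atTop (𝓝 1) := by
          simpa using (tendsto_const_nhds (x := (1:ℝ))).sub
            ((tendsto_const_nhds (x := (N:ℝ))).div_atTop tendsto_id)
        simpa using ((aux_lim _ hV).mul h2).div_const (R + 2 * ε)
      filter_upwards [hlim.eventually (lt_mem_nhds hεa), eventually_gt_atTop 1,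
        eventually_gt_atTop (N:ℝ)] with p h1 h2 h3
      exact h1.trans_le (aux_lower Ω hΩo hΩb hΩne hc R hR hR0 ε hε p h2 h3)
    · have ha0 : 0 < a := lt_trans (by positivity) ha
      have haR : 1 / a < R := by rwa [one_div_lt ha0 hR0]
      obtain ⟨_, ⟨x0, hx0, rfl⟩, hs⟩ := exists_lt_of_lt_csSup (hΩne.image _) haR
      obtain ⟨r, hr1, hr2⟩ := exists_between hs
      have hr0 : 0 < r := lt_trans (by positivity) hr1
      have hball : ball x0 (infDist x0 Ωᶜ) ⊆ Ω := by
        intro z hz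
        by_contra hz'
        have := infDist_le_dist_of_mem (x := x0) (show z ∈ Ωᶜ from hz')
        rw [mem_ball, dist_comm] at hz
        linarith
      have hra : 1 / r < a := by rwa [one_div_lt hr0 ha0]
      have hlim : Tendsto (fun p : ℝ => 1 / r * (volume Ω).toReal ^ (1 / p)) atTop (𝓝 (1 / r)) := by
        simpa using (aux_lim _ hvol).const_mul (1 / r)
      filter_upwards [hlim.eventually (gt_mem_nhds hra), eventually_gt_atTop 0] with p h1 h2
      exact (aux_upper Ω hΩb x0 r _ hr0 hr2 hball p h2).trans_lt h1
  refine ⟨main, ?_⟩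
  have h := main.mul ((aux_lim _ hvol).inv₀ one_ne_zero)
  simp only [inv_one, mul_one] at h
  refine h.congr fun p => ?_
  rw [Real.rpow_neg hvol.le]
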